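/- Let X, X₁, …, Xₙ be i.i.d. real-valued random variables with M(1) > 0, and let a = (a₁, …, aₙ) with aₖ ∈ ℝ^d be such that 𝑁 = Σₖ aₖaₖᵀ is positive definite. Let α > 0 and γ ∈ (0,1), and suppose that (Σₖ(⟨t,aₖ⟩ − mₖ)²)^{1/2} ≥ min{γ‖t·a‖, α} for all integers m₁, …, mₙ and all t ∈ ℝ^d with ‖t‖ ≤ √d. Then there exist absolute constants c₁, c₂ > 0 such that Q(F_a, √d) ≤ c₁^d ( (γ √M(1))^{-d} (det 𝑁)^{-1/2} + exp(−c₂ α² M(1)) ). -/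

import Mathlib

open MeasureTheory
open scoped RealInnerProductSpace

/-- Concentration function `Q(μ, r) = sup_x μ(x + rB)` of a measure on `ℝ^d`. -/
noncomputable def concFn {d : ℕ} (μ : Measure (EuclideanSpace ℝ (Fin d))) (r : ℝ) : ℝ :=
  ⨆ x : EuclideanSpace ℝ (Fin d), (μ (Metric.closedBall x r)).toReal

/-- Law of `S_a = ∑ k, X_k • a_k`, where `X_1, …, X_n` are i.i.d. with law `ν`. -/
noncomputable def sumLaw {d n : ℕ} (ν : Measure ℝ) (a : Fin n → EuclideanSpace ℝ (Fin d)) :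
    Measure (EuclideanSpace ℝ (Fin d)) :=
  (Measure.pi fun _ : Fin n => ν).map (fun ω => ∑ k, ω k • a k)

/-- `M(τ) = E min(X̃²/τ², 1)`, where `X̃ = X₁ - X₂` with `X₁, X₂` i.i.d. of law `ν`. -/
noncomputable def Mfn (ν : Measure ℝ) (τ : ℝ) : ℝ :=
  ∫ p : ℝ × ℝ, min ((p.1 - p.2) ^ 2 / τ ^ 2) 1 ∂(ν.prod ν)

/-- The matrix `𝑁 = ∑ k, aₖ aₖᵀ`. -/
noncomputable def covMat {d n : ℕ} (a : Fin n → EuclideanSpace ℝ (Fin d)) :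
    Matrix (Fin d) (Fin d) ℝ :=
  Matrix.of fun i j => ∑ k, a k i * a k j

lemma cube_volume {d : ℕ} (y : EuclideanSpace ℝ (Fin d)) {r : ℝ} (hr : 0 ≤ r) :
    volume {u : EuclideanSpace ℝ (Fin d) | ∀ i, |u i - y i| ≤ r} =
      ENNReal.ofReal ((2 * r) ^ d) := by
  have h : {u : EuclideanSpace ℝ (Fin d) | ∀ i, |u i - y i| ≤ r}
      = WithLp.ofLp ⁻¹' (Metric.closedBall (WithLp.ofLp y) r) := by
    ext u
    simp [Metric.mem_closedBall, dist_pi_le_iff hr, Real.dist_eq]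
  rw [h, (PiLp.volume_preserving_ofLp (Fin d)).measure_preimage
    Metric.isClosed_closedBall.measurableSet.nullMeasurableSet, Real.volume_pi_closedBall _ hr,
    Fintype.card_fin]

lemma isCompact_cube {d : ℕ} (y : EuclideanSpace ℝ (Fin d)) {r : ℝ} (hr : 0 ≤ r) :
    IsCompact {u : EuclideanSpace ℝ (Fin d) | ∀ i, |u i - y i| ≤ r} := by
  have h : {u : EuclideanSpace ℝ (Fin d) | ∀ i, |u i - y i| ≤ r}
      = (EuclideanSpace.equiv (Fin d) ℝ).toHomeomorph ⁻¹'
        (Metric.closedBall (WithLp.ofLp y) r) := by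
    ext u
    simp [Metric.mem_closedBall, dist_pi_le_iff hr, Real.dist_eq]
  rw [h, Homeomorph.isCompact_preimage]
  exact isCompact_closedBall _ _

lemma norm_le_of_abs_le {d : ℕ} (u : EuclideanSpace ℝ (Fin d)) {r : ℝ} (hr : 0 ≤ r)
    (hu : ∀ i, |u i| ≤ r) : ‖u‖ ≤ r * √d := by
  rw [EuclideanSpace.norm_eq]
  apply Real.sqrt_le_iff.2 ⟨by positivity, ?_⟩
  rw [mul_pow, Real.sq_sqrt (by positivity)]
  calc ∑ i, ‖u i‖ ^ 2 ≤ ∑ _i : Fin d, r ^ 2 :=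
        Finset.sum_le_sum fun i _ => by
          rw [Real.norm_eq_abs]; gcongr; exact hu i
    _ = r ^ 2 * d := by simp [mul_comm]

lemma integrable_exp_neg_mul_sq_norm {V : Type*} [NormedAddCommGroup V]
    [InnerProductSpace ℝ V] [FiniteDimensional ℝ V] [MeasurableSpace V] [BorelSpace V]
    {b : ℝ} (hb : 0 < b) : Integrable (fun t : V => Real.exp (-b * ‖t‖ ^ 2)) := by
  have := (GaussianFourier.integrable_cexp_neg_mul_sq_norm_add (V := V) (b := b)
    (by simpa using hb) 0 0).norm
  refine this.congr (Filter.Eventually.of_forall fun t => ?_)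
  simp [Complex.norm_exp, ← Complex.ofReal_pow, ← Complex.ofReal_mul]

/-- Esseen's inequality with a Gaussian weight. -/
lemma measure_closedBall_le_integral_charFun {V : Type*} [NormedAddCommGroup V]
    [InnerProductSpace ℝ V] [FiniteDimensional ℝ V] [MeasurableSpace V] [BorelSpace V]
    (μ : Measure V) [IsProbabilityMeasure μ] (x : V) (r : ℝ) :
    (μ (Metric.closedBall x r)).toReal ≤
      Real.exp (Real.pi * r ^ 2) *
        ∫ t : V, Real.exp (-Real.pi * ‖t‖ ^ 2) * ‖charFun μ ((2 * Real.pi) • t)‖ := by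
  have hgauss_int : Integrable (fun t : V => Real.exp (-Real.pi * ‖t‖ ^ 2)) :=
    integrable_exp_neg_mul_sq_norm Real.pi_pos
  have hgauss : ∀ w : V, (Real.exp (-Real.pi * ‖w‖ ^ 2) : ℂ) =
      ∫ t : V, Complex.exp (((-2 * Real.pi * inner ℝ t w : ℝ) : ℂ) * Complex.I) *
        (Real.exp (-Real.pi * ‖t‖ ^ 2) : ℂ) := by
    intro w
    have h := fourier_gaussian_innerProductSpace (V := V) (b := Real.pi)
      (by simpa using Real.pi_pos) w
    rw [Real.fourier_eq'] at h
    have hpi : (Real.pi : ℂ) ≠ 0 := by exact_mod_cast Real.pi_ne_zero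
    rw [div_self hpi, Complex.one_cpow, one_mul] at h
    simp only [smul_eq_mul] at h
    push_cast at h ⊢
    rw [h]
    congr 1
    field_simp
  have hexp : ((∫ y, Real.exp (-Real.pi * ‖x - y‖ ^ 2) ∂μ : ℝ) : ℂ) =
      ∫ t : V, Complex.exp (((-2 * Real.pi * inner ℝ t x : ℝ) : ℂ) * Complex.I) *
        (Real.exp (-Real.pi * ‖t‖ ^ 2) : ℂ) * charFun μ ((2 * Real.pi) • t) := by
    rw [← integral_complex_ofReal,
      integral_congr_ae (Filter.Eventually.of_forall fun y => hgauss (x - y)), integral_integral_swap]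
    · refine integral_congr_ae (Filter.Eventually.of_forall fun t => ?_)
      simp only
      rw [charFun_apply, ← integral_const_mul]
      refine integral_congr_ae (Filter.Eventually.of_forall fun y => ?_)
      simp only
      conv_rhs => rw [mul_right_comm, ← Complex.exp_add]
      congr 2
      rw [inner_sub_right, inner_smul_right, real_inner_comm y t]
      push_cast
      ring
    · have h2 : Integrable (fun p : V × V => Real.exp (-Real.pi * ‖p.2‖ ^ 2)) (μ.prod volume) :=
        hgauss_int.comp_snd μ
      refine h2.mono' ?_ (Filter.Eventually.of_forall fun p => ?_)
      · apply Continuous.aestronglyMeasurable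
        unfold Function.uncurry
        fun_prop
      · simp only [Function.uncurry]
        rw [norm_mul, Complex.norm_exp_ofReal_mul_I, one_mul, Complex.norm_real]
        simp
  have hle : (∫ y, Real.exp (-Real.pi * ‖x - y‖ ^ 2) ∂μ) ≤
      ∫ t : V, Real.exp (-Real.pi * ‖t‖ ^ 2) * ‖charFun μ ((2 * Real.pi) • t)‖ := by
    calc _ ≤ ‖((∫ y, Real.exp (-Real.pi * ‖x - y‖ ^ 2) ∂μ : ℝ) : ℂ)‖ := by
          rw [Complex.norm_real]; exact le_abs_self _
      _ ≤ _ := by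
          rw [hexp]
          refine (norm_integral_le_integral_norm _).trans (le_of_eq ?_)
          refine integral_congr_ae (Filter.Eventually.of_forall fun t => ?_)
          simp only
          rw [norm_mul, norm_mul, Complex.norm_exp_ofReal_mul_I, one_mul, Complex.norm_real,
            Real.norm_of_nonneg (Real.exp_pos _).le]
  refine le_trans ?_ (mul_le_mul_of_nonneg_left hle (Real.exp_pos _).le)
  rw [← integral_const_mul, ← measureReal_def,
    ← integral_indicator_one Metric.isClosed_closedBall.measurableSet]
  refine integral_mono_of_nonneg ?_ ?_ (Filter.Eventually.of_forall fun y => ?_)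
  · exact Filter.Eventually.of_forall fun y => Set.indicator_nonneg (fun _ _ => zero_le_one) _
  · refine Integrable.of_bound (C := Real.exp (Real.pi * r ^ 2))
      (Continuous.aestronglyMeasurable (by fun_prop)) (Filter.Eventually.of_forall fun y => ?_)
    rw [Real.norm_of_nonneg (by positivity)]
    refine mul_le_of_le_one_right (Real.exp_pos _).le (Real.exp_le_one_iff.2 ?_)
    have := Real.pi_pos
    have : 0 ≤ Real.pi * ‖x - y‖ ^ 2 := by positivity
    linarith
  · by_cases hy : y ∈ Metric.closedBall x r
    · simp only [Set.indicator_of_mem hy, Pi.one_apply]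
      rw [← Real.exp_add]
      refine Real.one_le_exp ?_
      rw [Metric.mem_closedBall, dist_comm, dist_eq_norm] at hy
      have : ‖x - y‖ ^ 2 ≤ r ^ 2 := by gcongr
      nlinarith [Real.pi_pos]
    · simp only [Set.indicator_of_notMem hy]
      positivity

lemma charFun_sumLaw {d n : ℕ} (ν : Measure ℝ) [IsProbabilityMeasure ν]
    (a : Fin n → EuclideanSpace ℝ (Fin d)) (t : EuclideanSpace ℝ (Fin d)) :
    charFun (sumLaw ν a) t = ∏ k, charFun ν ⟪t, a k⟫ := by
  rw [charFun_apply, sumLaw, integral_map (Continuous.aemeasurable (by fun_prop))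
    (Continuous.aestronglyMeasurable (by fun_prop))]
  simp_rw [charFun_apply]
  rw [← integral_fintype_prod_eq_prod]
  congr 1
  ext ω
  rw [← Complex.exp_sum, sum_inner, ← Finset.sum_mul]
  congr 2
  push_cast
  refine Finset.sum_congr rfl fun k _ => ?_
  rw [real_inner_smul_left, real_inner_comm]
  simp [mul_comm]

lemma normSq_charFun_eq_integral_cos (ν : Measure ℝ) [IsProbabilityMeasure ν] (s : ℝ) :
    ‖charFun ν s‖ ^ 2 = ∫ p : ℝ × ℝ, Real.cos (s * (p.1 - p.2)) ∂(ν.prod ν) := by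
  have h : ((‖charFun ν s‖ ^ 2 : ℝ) : ℂ) =
      ∫ p : ℝ × ℝ, Complex.exp ((s * (p.1 - p.2) : ℝ) * Complex.I) ∂(ν.prod ν) := by
    rw [Complex.ofReal_pow, ← Complex.mul_conj', ← charFun_neg, charFun_apply, charFun_apply,
      ← integral_prod_mul]
    congr 1
    ext p
    rw [← Complex.exp_add]
    congr 1
    simp
    ring
  have h2 := congrArg Complex.re h
  rw [Complex.ofReal_re] at h2
  rw [h2, ← RCLike.re_eq_complex_re, ← integral_re]
  · refine integral_congr_ae (Filter.Eventually.of_forall fun p => ?_)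
    simp only [RCLike.re_eq_complex_re, Complex.exp_ofReal_mul_I_re]
  · refine Integrable.of_bound (C := 1) (Continuous.aestronglyMeasurable (by fun_prop))
      (Filter.Eventually.of_forall fun p => ?_)
    rw [Complex.norm_exp_ofReal_mul_I]

lemma norm_charFun_le_exp (ν : Measure ℝ) [IsProbabilityMeasure ν] (s : ℝ) :
    ‖charFun ν s‖ ≤
      Real.exp (-(1 / 2) * ∫ p : ℝ × ℝ, (1 - Real.cos (s * (p.1 - p.2))) ∂(ν.prod ν)) := by
  have hi : Integrable (fun p : ℝ × ℝ => Real.cos (s * (p.1 - p.2))) (ν.prod ν) :=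
    Integrable.of_bound (C := 1) (Continuous.aestronglyMeasurable (by fun_prop))
      (Filter.Eventually.of_forall fun p => Real.abs_cos_le_one _)
  rw [integral_sub (integrable_const _) hi, ← normSq_charFun_eq_integral_cos]
  refine le_of_sq_le_sq ?_ (Real.exp_pos _).le
  rw [← Real.exp_nat_mul]
  have h := Real.add_one_le_exp (‖charFun ν s‖ ^ 2 - 1)
  simp only [integral_const, probReal_univ, smul_eq_mul]
  convert! h using 2 <;> · push_cast; ring

/-- A weighted form of Jensen's inequality for the exponential function. -/
lemma exp_neg_integral_le {Ω : Type*} [MeasurableSpace Ω] (P : Measure Ω) [IsProbabilityMeasure P]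
    {w h : Ω → ℝ} (hw : Integrable w P) (hh : Integrable h P) (hw0 : ∀ p, 0 ≤ w p)
    (hh0 : ∀ p, 0 ≤ h p) (hwh : ∀ p, w p = 0 → h p = 0) (hM : 0 < ∫ p, w p ∂P)
    {c : ℝ} (hc : 0 ≤ c) :
    Real.exp (-c * ∫ p, h p ∂P) ≤
      (∫ p, w p ∂P)⁻¹ * ∫ p, w p * Real.exp (-c * (∫ p, w p ∂P) * (h p / w p)) ∂P := by
  set M := ∫ p, w p ∂P with hMdef
  set y := c * ∫ p, h p ∂P with hy
  have hle : ∫ p, Real.exp (-y) * ((1 + y) * w p - c * M * h p) ∂P ≤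
      ∫ p, w p * Real.exp (-c * M * (h p / w p)) ∂P := by
    refine integral_mono (((hw.const_mul _).sub (hh.const_mul _)).const_mul _) ?_ fun p => ?_
    · refine hw.mono' ?_ (Filter.Eventually.of_forall fun p => ?_)
      · exact hw.1.mul (((hh.aemeasurable.div hw.aemeasurable).const_mul
          (-c * M)).exp.aestronglyMeasurable)
      · rw [Real.norm_of_nonneg (mul_nonneg (hw0 p) (Real.exp_pos _).le)]
        refine mul_le_of_le_one_right (hw0 p) (Real.exp_le_one_iff.2 ?_)
        have : 0 ≤ c * M * (h p / w p) :=
          mul_nonneg (mul_nonneg hc hM.le) (div_nonneg (hh0 p) (hw0 p))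
        linarith
    · simp only
      rcases (hw0 p).eq_or_lt' with h0 | h0
      · simp [h0, hwh p h0]
      · have h1 := Real.add_one_le_exp (-c * M * (h p / w p) + y)
        rw [Real.exp_add] at h1
        have h2 : h p = w p * (h p / w p) := by field_simp
        calc Real.exp (-y) * ((1 + y) * w p - c * M * h p)
            = w p * Real.exp (-y) * (-c * M * (h p / w p) + y + 1) := by
              rw [h2]; field_simp; ring
          _ ≤ w p * Real.exp (-y) * (Real.exp (-c * M * (h p / w p)) * Real.exp y) := by
              gcongr
          _ = _ := by
              rw [Real.exp_neg]; field_simp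
  rw [integral_const_mul, integral_sub (hw.const_mul _) (hh.const_mul _), integral_const_mul,
    integral_const_mul, ← hMdef] at hle
  rw [inv_mul_eq_div, le_div_iff₀ hM, neg_mul, ← hy]
  refine le_trans (le_of_eq ?_) hle
  rw [hy]
  ring

lemma one_sub_cos_sub_le (x y : ℝ) :
    1 - Real.cos (x - y) ≤ 2 * (1 - Real.cos x) + 2 * (1 - Real.cos y) := by
  rw [Real.cos_sub]
  have hx := Real.sin_sq_add_cos_sq x
  have hy := Real.sin_sq_add_cos_sq y
  nlinarith [sq_nonneg (Real.cos x + Real.cos y - 2), sq_nonneg (Real.sin x + Real.sin y)]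

lemma sub_round_sq_le (x : ℝ) : 8 * (x - round x) ^ 2 ≤ 1 - Real.cos (2 * Real.pi * x) := by
  have hpi := Real.pi_pos
  have h1 : Real.cos (2 * Real.pi * x) = Real.cos (2 * Real.pi * (x - round x)) := by
    rw [mul_sub, mul_comm (2 * Real.pi) (round x : ℝ), Real.cos_sub_int_mul_two_pi]
  have h2 : |2 * Real.pi * (x - round x)| ≤ Real.pi := by
    rw [abs_mul, abs_of_pos (by positivity)]
    nlinarith [abs_sub_round x]
  have h3 := Real.cos_le_one_sub_mul_cos_sq h2
  rw [h1]
  have h4 : 2 / Real.pi ^ 2 * (2 * Real.pi * (x - round x)) ^ 2 = 8 * (x - round x) ^ 2 := by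
    field_simp; ring
  linarith

lemma integral_exp_neg_quadratic {d : ℕ} {A : Matrix (Fin d) (Fin d) ℝ} (hA : A.PosDef)
    (b : ℝ) :
    ∫ u : EuclideanSpace ℝ (Fin d), Real.exp (-b * (u.ofLp ⬝ᵥ A.mulVec u.ofLp))
      = √(Real.pi / b) ^ d * (1 / √A.det) := by
  classical
  obtain ⟨B, hB⟩ : ∃ B : Matrix (Fin d) (Fin d) ℝ, A = B.transpose * B := by
    open scoped MatrixOrder in
    obtain ⟨B, hB⟩ := CStarAlgebra.nonneg_iff_eq_star_mul_self.1 hA.posSemidef.nonneg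
    exact ⟨B, by rw [hB, Matrix.star_eq_conjTranspose]; rfl⟩
  have hdet : A.det = B.det ^ 2 := by rw [hB, Matrix.det_mul, Matrix.det_transpose, sq]
  have hB0 : B.det ≠ 0 := by
    intro h
    have := hA.det_pos
    rw [hdet, h] at this
    simp at this
  have e1 : ∫ u : EuclideanSpace ℝ (Fin d), Real.exp (-b * (u.ofLp ⬝ᵥ A.mulVec u.ofLp))
      = ∫ v : Fin d → ℝ, ∏ i, Real.exp (-b * (Matrix.toLin' B v i) ^ 2) := by
    rw [← (PiLp.volume_preserving_ofLp (Fin d)).integral_comp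
      (MeasurableEquiv.toLp 2 (Fin d → ℝ)).symm.measurableEmbedding]
    congr 1
    ext u
    rw [← Real.exp_sum, ← Finset.mul_sum, hB, ← Matrix.mulVec_mulVec, Matrix.dotProduct_mulVec,
      Matrix.vecMul_transpose]
    simp [dotProduct, sq]
  have hmap := Real.map_matrix_volume_pi_eq_smul_volume_pi hB0
  have e2 : ∫ v : Fin d → ℝ, ∏ i, Real.exp (-b * (Matrix.toLin' B v i) ^ 2)
      = ∫ v, ∏ i, Real.exp (-b * (v i) ^ 2) ∂(Measure.map (Matrix.toLin' B) volume) := by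
    rw [integral_map (LinearMap.continuous_of_finiteDimensional _).aemeasurable
      (Continuous.aestronglyMeasurable (by fun_prop))]
  rw [e1, e2, hmap, integral_smul_measure, integral_fintype_prod_volume_eq_prod
    (fun _ x => Real.exp (-b * x ^ 2)), hdet, Real.sqrt_sq_eq_abs]
  simp only [integral_gaussian]
  simp [abs_inv, mul_comm]

/-- A Gaussian average is controlled by the averages over all translates of a small cube. -/
lemma integral_gaussian_mul_le_of_cube {d : ℕ} {G : EuclideanSpace ℝ (Fin d) → ℝ}
    (hG : Measurable G) (hG0 : ∀ t, 0 ≤ G t) (hG1 : ∀ t, G t ≤ 1) {ρ B : ℝ} (hρ : 0 < ρ)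
    (hρ1 : ρ ≤ 1)
    (h : ∀ y : EuclideanSpace ℝ (Fin d),
      ∫ t in {t : EuclideanSpace ℝ (Fin d) | ∀ i, |t i - y i| ≤ ρ / 2}, G t ≤ ρ ^ d * B) :
    ∫ t : EuclideanSpace ℝ (Fin d), Real.exp (-Real.pi * ‖t‖ ^ 2) * G t
      ≤ (Real.exp (Real.pi / 4) * √2) ^ d * B := by
  have hpi := Real.pi_pos
  set cube : EuclideanSpace ℝ (Fin d) → Set (EuclideanSpace ℝ (Fin d)) :=
    fun y => {t | ∀ i, |t i - y i| ≤ ρ / 2} with hcube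
  set S : Set (EuclideanSpace ℝ (Fin d) × EuclideanSpace ℝ (Fin d)) :=
    {p | ∀ i, |p.1 i - p.2 i| ≤ ρ / 2} with hS
  have hSm : MeasurableSet S := by
    apply IsClosed.measurableSet
    rw [hS, Set.ofPred_forall]
    exact isClosed_iInter fun i => isClosed_le (by fun_prop) continuous_const
  have hcm : ∀ y, MeasurableSet (cube y) := fun y => (isCompact_cube y (by positivity)).measurableSet
  have hvol : ∀ y, volume.real (cube y) = ρ ^ d := by
    intro y
    rw [measureReal_def, hcube, cube_volume y (by positivity), mul_div_cancel₀ _ two_ne_zero,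
      ENNReal.toReal_ofReal (by positivity)]
  have hnear : ∀ p ∈ S, ‖p.2‖ ^ 2 ≤ 2 * ‖p.1‖ ^ 2 + d / 2 := by
    intro p hp
    have h1 : ‖p.1 - p.2‖ ≤ 1 / 2 * √d :=
      (norm_le_of_abs_le (p.1 - p.2) (half_pos hρ).le fun i => by simpa using hp i).trans
        (by gcongr)
    have h2 : ‖p.1 - p.2‖ ^ 2 ≤ (d : ℝ) / 4 := by
      calc ‖p.1 - p.2‖ ^ 2 ≤ (1 / 2 * √d) ^ 2 := by gcongr
        _ = (d : ℝ) / 4 := by rw [mul_pow, Real.sq_sqrt (by positivity)]; ring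
    have h3 : ‖p.2‖ ≤ ‖p.1‖ + ‖p.1 - p.2‖ := by
      have := norm_sub_le p.1 (p.1 - p.2)
      simpa using this
    calc ‖p.2‖ ^ 2 ≤ (‖p.1‖ + ‖p.1 - p.2‖) ^ 2 := by gcongr
      _ ≤ _ := by nlinarith [sq_nonneg (‖p.1‖ - ‖p.1 - p.2‖)]
  set Φ : EuclideanSpace ℝ (Fin d) × EuclideanSpace ℝ (Fin d) → ℝ :=
    S.indicator (fun p => Real.exp (-Real.pi * ‖p.1‖ ^ 2) * G p.1) with hΦ
  have hΦm : Measurable Φ := by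
    apply Measurable.indicator _ hSm
    exact (Continuous.measurable (by fun_prop)).mul (hG.comp measurable_fst)
  have hΦi : Integrable Φ (volume.prod volume) := by
    have h1 := (integrable_exp_neg_mul_sq_norm (V := EuclideanSpace ℝ (Fin d))
      (b := Real.pi / 2) (by positivity)).mul_prod
      (integrable_exp_neg_mul_sq_norm (V := EuclideanSpace ℝ (Fin d)) (b := Real.pi / 4) (by positivity))
    refine (h1.const_mul (Real.exp (Real.pi * d / 8))).mono' hΦm.aestronglyMeasurable
      (Filter.Eventually.of_forall fun p => ?_)
    by_cases hp : p ∈ S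
    · rw [hΦ, Set.indicator_of_mem hp, Real.norm_of_nonneg (mul_nonneg (Real.exp_pos _).le (hG0 _))]
      refine (mul_le_of_le_one_right (Real.exp_pos _).le (hG1 _)).trans ?_
      rw [← Real.exp_add, ← Real.exp_add]
      apply Real.exp_le_exp.2
      nlinarith [hnear p hp]
    · rw [hΦ, Set.indicator_of_notMem hp, norm_zero]
      positivity
  have e1 : ∀ t, ∫ y, Φ (t, y) = ρ ^ d * (Real.exp (-Real.pi * ‖t‖ ^ 2) * G t) := by
    intro t
    have : (fun y => Φ (t, y)) =
        (cube t).indicator (fun _ => Real.exp (-Real.pi * ‖t‖ ^ 2) * G t) := by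
      ext y
      simp only [hΦ, Set.indicator, hS, hcube, Set.mem_ofPred_eq, abs_sub_comm]
    rw [this, integral_indicator_const _ (hcm t), hvol, smul_eq_mul]
  have e2 : ∀ y, ∫ t, Φ (t, y) ≤
      Real.exp (Real.pi * d / 4) * (ρ ^ d * B) * Real.exp (-(Real.pi / 2) * ‖y‖ ^ 2) := by
    intro y
    have hGi : IntegrableOn G (cube y) := by
      refine Measure.integrableOn_of_bounded (M := 1)
        (isCompact_cube y (by positivity)).measure_lt_top.ne hG.aestronglyMeasurable
        (Filter.Eventually.of_forall fun t => ?_)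
      rw [Real.norm_of_nonneg (hG0 t)]
      exact hG1 t
    calc ∫ t, Φ (t, y) ≤ ∫ t, Real.exp (Real.pi * d / 4) * Real.exp (-(Real.pi / 2) * ‖y‖ ^ 2) *
          (cube y).indicator G t := by
          refine integral_mono_of_nonneg ?_ ((hGi.integrable_indicator (hcm y)).const_mul _) ?_
          · exact Filter.Eventually.of_forall fun t => Set.indicator_nonneg
              (fun p _ => mul_nonneg (Real.exp_pos _).le (hG0 _)) _
          · refine Filter.Eventually.of_forall fun t => ?_
            by_cases hp : (t, y) ∈ S
            · have hp' : t ∈ cube y := hp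
              simp only [hΦ, Set.indicator_of_mem hp, Set.indicator_of_mem hp']
              refine mul_le_mul_of_nonneg_right ?_ (hG0 t)
              rw [← Real.exp_add]
              apply Real.exp_le_exp.2
              nlinarith [hnear _ hp]
            · have hp' : t ∉ cube y := hp
              simp only [hΦ, Set.indicator_of_notMem hp, Set.indicator_of_notMem hp', mul_zero,
                le_refl]
      _ = Real.exp (Real.pi * d / 4) * Real.exp (-(Real.pi / 2) * ‖y‖ ^ 2) *
          ∫ t in cube y, G t := by
          rw [integral_const_mul, integral_indicator (hcm y)]
      _ ≤ Real.exp (Real.pi * d / 4) * Real.exp (-(Real.pi / 2) * ‖y‖ ^ 2) * (ρ ^ d * B) := by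
          gcongr
          exact h y
      _ = _ := by ring
  have key : ρ ^ d * ∫ t : EuclideanSpace ℝ (Fin d), Real.exp (-Real.pi * ‖t‖ ^ 2) * G t ≤
      ρ ^ d * ((Real.exp (Real.pi / 4) * √2) ^ d * B) := by
    calc ρ ^ d * ∫ t : EuclideanSpace ℝ (Fin d), Real.exp (-Real.pi * ‖t‖ ^ 2) * G t
        = ∫ t, ∫ y, Φ (t, y) := by
          simp_rw [e1]
          rw [integral_const_mul]
      _ = ∫ y, ∫ t, Φ (t, y) := integral_integral_swap hΦi
      _ ≤ ∫ y : EuclideanSpace ℝ (Fin d), Real.exp (Real.pi * d / 4) * (ρ ^ d * B) *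
            Real.exp (-(Real.pi / 2) * ‖y‖ ^ 2) :=
          integral_mono hΦi.integral_prod_right
            ((integrable_exp_neg_mul_sq_norm (by positivity)).const_mul _) e2
      _ = ρ ^ d * ((Real.exp (Real.pi / 4) * √2) ^ d * B) := by
          rw [integral_const_mul, GaussianFourier.integral_rexp_neg_mul_sq_norm (by positivity),
            finrank_euclideanSpace_fin, show Real.pi / (Real.pi / 2) = 2 by field_simp,
            mul_pow, ← Real.exp_nat_mul, Real.sqrt_eq_rpow, ← Real.rpow_natCast (2 ^ (1 / 2 : ℝ)) d,
            ← Real.rpow_mul (by norm_num)]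
          rw [show (d : ℝ) * (Real.pi / 4) = Real.pi * d / 4 by ring,
            show (1 / 2 : ℝ) * d = d / 2 by ring]
          ring
  exact le_of_mul_le_mul_left key (pow_pos hρ d)

lemma dotProduct_covMat_mulVec {d n : ℕ} (a : Fin n → EuclideanSpace ℝ (Fin d))
    (u : EuclideanSpace ℝ (Fin d)) :
    u.ofLp ⬝ᵥ (covMat a).mulVec u.ofLp = ∑ k, ⟪u, a k⟫ ^ 2 := by
  simp only [dotProduct, Matrix.mulVec, covMat, Matrix.of_apply, PiLp.inner_apply, sq,
    Finset.sum_mul, Finset.mul_sum]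
  rw [Finset.sum_congr rfl fun i _ => Finset.sum_comm, Finset.sum_comm]
  refine Finset.sum_congr rfl fun k _ => Finset.sum_congr rfl fun i _ =>
    Finset.sum_congr rfl fun j _ => ?_
  simp
  ring

/-- The trigonometric substitute for the squared distance from `(⟪t, a k⟫)ₖ` to `ℤⁿ`. -/
noncomputable def cosEnergy {d n : ℕ} (a : Fin n → EuclideanSpace ℝ (Fin d))
    (t : EuclideanSpace ℝ (Fin d)) : ℝ :=
  ∑ k, (1 - Real.cos (2 * Real.pi * ⟪t, a k⟫))

section CosEnergy

variable {d n : ℕ} (a : Fin n → EuclideanSpace ℝ (Fin d))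

lemma continuous_cosEnergy : Continuous (cosEnergy a) := by
  unfold cosEnergy
  fun_prop

lemma cosEnergy_nonneg (t : EuclideanSpace ℝ (Fin d)) : 0 ≤ cosEnergy a t :=
  Finset.sum_nonneg fun _ _ => sub_nonneg.2 (Real.cos_le_one _)

lemma cosEnergy_le (t : EuclideanSpace ℝ (Fin d)) : cosEnergy a t ≤ 2 * n := by
  calc cosEnergy a t ≤ ∑ _k : Fin n, (2 : ℝ) :=
        Finset.sum_le_sum fun k _ => by linarith [Real.neg_one_le_cos (2 * Real.pi * ⟪t, a k⟫)]
    _ = 2 * n := by simp [mul_comm]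

lemma cosEnergy_sub_le (s t : EuclideanSpace ℝ (Fin d)) :
    cosEnergy a (s - t) ≤ 2 * cosEnergy a s + 2 * cosEnergy a t := by
  simp only [cosEnergy, Finset.mul_sum, ← Finset.sum_add_distrib]
  refine Finset.sum_le_sum fun k _ => ?_
  rw [inner_sub_left, mul_sub]
  exact one_sub_cos_sub_le _ _

lemma sum_sub_round_sq_le_cosEnergy (t : EuclideanSpace ℝ (Fin d)) :
    8 * ∑ k, (⟪t, a k⟫ - round ⟪t, a k⟫) ^ 2 ≤ cosEnergy a t := by
  rw [Finset.mul_sum]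
  exact Finset.sum_le_sum fun k _ => sub_round_sq_le _

end CosEnergy

/-- Estimate of the Gaussian average of `exp (-cosEnergy)` along the dilation by `z`, obtained
by comparing each point of a cube of side `1 / max |z| 1` with a minimizer of the energy there. -/
lemma integral_gaussian_mul_exp_cosEnergy_le {d n : ℕ} {a : Fin n → EuclideanSpace ℝ (Fin d)}
    (hN : (covMat a).PosDef) {α γ M z : ℝ} (hα : 0 < α) (hγ : 0 < γ) (hM : 0 < M) (hz : z ≠ 0)
    (h : ∀ (m : Fin n → ℤ) (t : EuclideanSpace ℝ (Fin d)), ‖t‖ ≤ √d →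
      min (γ * √(∑ k, ⟪t, a k⟫ ^ 2)) α ≤ √(∑ k, (⟪t, a k⟫ - m k) ^ 2)) :
    ∫ t : EuclideanSpace ℝ (Fin d), Real.exp (-Real.pi * ‖t‖ ^ 2) *
        Real.exp (-(1 / 2) * M * (cosEnergy a (z • t) / min (z ^ 2) 1)) ≤
      (Real.exp (Real.pi / 4) * √2) ^ d *
        (√Real.pi ^ d * ((1 / (γ * √M)) ^ d * (1 / √(covMat a).det)) +
          Real.exp (-1 * α ^ 2 * M)) := by
  set q := max |z| 1 with hq
  set w := min (z ^ 2) 1 with hw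
  have hq1 : 1 ≤ q := le_max_right _ _
  have hq0 : 0 < q := by linarith
  have hzq : |z| ≤ q := le_max_left _ _
  have hw0 : 0 < w := lt_min (by positivity) one_pos
  have hw1 : w ≤ 1 := min_le_right _ _
  have hwq : z ^ 2 = w * q ^ 2 := by
    rcases le_total |z| 1 with h1 | h1
    · have h2 : z ^ 2 ≤ 1 := (sq_le_one_iff_abs_le_one z).2 h1
      rw [hw, hq, max_eq_right h1, min_eq_left h2]; ring
    · have h2 : 1 ≤ z ^ 2 := (one_le_sq_iff_one_le_abs z).2 h1
      rw [hw, hq, max_eq_left h1, min_eq_right h2, sq_abs]; ring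
  have hdet := hN.det_pos
  have hE := continuous_cosEnergy a
  refine integral_gaussian_mul_le_of_cube (ρ := 1 / q) (Continuous.measurable (by fun_prop))
    (fun t => (Real.exp_pos _).le) (fun t => Real.exp_le_one_iff.2 ?_) (by positivity)
    ((div_le_one hq0).2 hq1) fun y => ?_
  · have := mul_nonneg (mul_nonneg (by norm_num : (0 : ℝ) ≤ 1 / 2) hM.le)
      (div_nonneg (cosEnergy_nonneg a (z • t)) hw0.le)
    linarith
  set cube := {t : EuclideanSpace ℝ (Fin d) | ∀ i, |t i - y i| ≤ 1 / q / 2} with hcube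
  have hcomp : IsCompact cube := isCompact_cube y (by positivity)
  have hvol : volume.real cube = (1 / q) ^ d := by
    rw [measureReal_def, hcube, cube_volume y (by positivity), mul_div_cancel₀ _ two_ne_zero,
      ENNReal.toReal_ofReal (by positivity)]
  have hne : cube.Nonempty := ⟨y, fun i => by rw [sub_self, abs_zero]; positivity⟩
  obtain ⟨t₀, ht₀, hmin⟩ := hcomp.exists_isMinOn hne
    (f := fun t => cosEnergy a (z • t)) (by fun_prop)
  set b := M * γ ^ 2 * q ^ 2 with hb
  have hb0 : 0 < b := by positivity
  have hpt : ∀ t ∈ cube, Real.exp (-(1 / 2) * M * (cosEnergy a (z • t) / w)) ≤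
      Real.exp (-b * ∑ k, ⟪t - t₀, a k⟫ ^ 2) + Real.exp (-1 * α ^ 2 * M) := by
    intro t ht
    have hu : ‖t - t₀‖ ≤ 1 / q * √d := by
      refine norm_le_of_abs_le _ (by positivity) fun i => ?_
      have h1 := abs_sub_le (t i) (y i) (t₀ i)
      have h2 := ht i
      have h3 := ht₀ i
      rw [abs_sub_comm] at h3
      simp only [PiLp.sub_apply]
      linarith
    have hzu : ‖z • (t - t₀)‖ ≤ √d := by
      rw [norm_smul, Real.norm_eq_abs]
      calc |z| * ‖t - t₀‖ ≤ q * (1 / q * √d) := by gcongr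
        _ = √d := by field_simp
    have h1 := h (fun k => round ⟪z • (t - t₀), a k⟫) (z • (t - t₀)) hzu
    have h2 := sum_sub_round_sq_le_cosEnergy a (z • (t - t₀))
    have h3 : cosEnergy a (z • (t - t₀)) ≤ 4 * cosEnergy a (z • t) := by
      have h4 := cosEnergy_sub_le a (z • t) (z • t₀)
      have h5 : cosEnergy a (z • t₀) ≤ cosEnergy a (z • t) := hmin ht
      rw [smul_sub]
      linarith
    have hq2 : ∑ k, ⟪z • (t - t₀), a k⟫ ^ 2 = z ^ 2 * ∑ k, ⟪t - t₀, a k⟫ ^ 2 := by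
      rw [Finset.mul_sum]
      refine Finset.sum_congr rfl fun k _ => ?_
      rw [real_inner_smul_left, mul_pow]
    rw [hq2] at h1
    have hQ0 : 0 ≤ ∑ k, ⟪t - t₀, a k⟫ ^ 2 := Finset.sum_nonneg fun _ _ => sq_nonneg _
    have hR0 : 0 ≤ ∑ k, (⟪z • (t - t₀), a k⟫ - round ⟪z • (t - t₀), a k⟫) ^ 2 :=
      Finset.sum_nonneg fun _ _ => sq_nonneg _
    set Q := ∑ k, ⟪t - t₀, a k⟫ ^ 2
    set R := ∑ k, (⟪z • (t - t₀), a k⟫ - round ⟪z • (t - t₀), a k⟫) ^ 2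
    rcases min_le_iff.1 h1 with h6 | h6
    · refine le_add_of_le_of_nonneg (Real.exp_le_exp.2 ?_) (Real.exp_pos _).le
      have h7 : γ ^ 2 * (z ^ 2 * Q) ≤ R := by
        have := pow_le_pow_left₀ (by positivity) h6 2
        rwa [mul_pow, Real.sq_sqrt (by positivity), Real.sq_sqrt hR0] at this
      have h8 : 2 * (γ ^ 2 * q ^ 2 * Q) ≤ cosEnergy a (z • t) / w := by
        rw [le_div_iff₀ hw0]
        rw [hwq] at h7
        linarith
      rw [hb]
      nlinarith
    · refine le_add_of_nonneg_of_le (Real.exp_pos _).le (Real.exp_le_exp.2 ?_)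
      have h7 : α ^ 2 ≤ R := by
        have := pow_le_pow_left₀ hα.le h6 2
        rwa [Real.sq_sqrt hR0] at this
      have h8 : 2 * α ^ 2 ≤ cosEnergy a (z • t) / w := by
        rw [le_div_iff₀ hw0]
        nlinarith [sq_nonneg α]
      nlinarith
  have hI : ∫ t, Real.exp (-b * ∑ k, ⟪t - t₀, a k⟫ ^ 2) =
      √(Real.pi / b) ^ d * (1 / √(covMat a).det) := by
    rw [← integral_exp_neg_quadratic hN b]
    simp_rw [dotProduct_covMat_mulVec]
    exact integral_sub_right_eq_self
      (fun u : EuclideanSpace ℝ (Fin d) => Real.exp (-b * ∑ k, ⟪u, a k⟫ ^ 2)) t₀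
  have hgauss_int : Integrable (fun t => Real.exp (-b * ∑ k, ⟪t - t₀, a k⟫ ^ 2)) := by
    by_contra hni
    rw [integral_undef hni] at hI
    have : 0 < √(Real.pi / b) ^ d * (1 / √(covMat a).det) := by
      have := Real.pi_pos
      positivity
    linarith
  have hci : IntegrableOn (fun _ : EuclideanSpace ℝ (Fin d) => Real.exp (-1 * α ^ 2 * M)) cube :=
    integrableOn_const hcomp.measure_lt_top.ne
  have hsq : √(Real.pi / b) = 1 / q * (√Real.pi * (1 / (γ * √M))) := by
    rw [Real.sqrt_div Real.pi_pos.le, hb, Real.sqrt_mul (by positivity),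
      Real.sqrt_mul hM.le, Real.sqrt_sq hγ.le, Real.sqrt_sq hq0.le]
    field_simp
  calc ∫ t in cube, Real.exp (-(1 / 2) * M * (cosEnergy a (z • t) / w))
      ≤ ∫ t in cube, (Real.exp (-b * ∑ k, ⟪t - t₀, a k⟫ ^ 2) + Real.exp (-1 * α ^ 2 * M)) :=
        setIntegral_mono_on
          (ContinuousOn.integrableOn_compact hcomp (Continuous.continuousOn (by fun_prop)))
          (hgauss_int.integrableOn.add hci) hcomp.measurableSet hpt
    _ = (∫ t in cube, Real.exp (-b * ∑ k, ⟪t - t₀, a k⟫ ^ 2)) +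
          (1 / q) ^ d * Real.exp (-1 * α ^ 2 * M) := by
        rw [integral_add hgauss_int.integrableOn hci, setIntegral_const, hvol, smul_eq_mul]
    _ ≤ (∫ t, Real.exp (-b * ∑ k, ⟪t - t₀, a k⟫ ^ 2)) +
          (1 / q) ^ d * Real.exp (-1 * α ^ 2 * M) := by
        exact add_le_add (setIntegral_le_integral hgauss_int
          (Filter.Eventually.of_forall fun t => (Real.exp_pos _).le)) le_rfl
    _ = _ := by
        rw [hI, hsq, mul_pow, mul_pow]
        ring

lemma norm_charFun_sumLaw_le {d n : ℕ} (ν : Measure ℝ) [IsProbabilityMeasure ν]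
    (a : Fin n → EuclideanSpace ℝ (Fin d)) (t : EuclideanSpace ℝ (Fin d)) :
    ‖charFun (sumLaw ν a) ((2 * Real.pi) • t)‖ ≤
      Real.exp (-(1 / 2) * ∫ p : ℝ × ℝ, cosEnergy a ((p.1 - p.2) • t) ∂(ν.prod ν)) := by
  rw [charFun_sumLaw, norm_prod]
  calc _ ≤ ∏ k, Real.exp (-(1 / 2) * ∫ p : ℝ × ℝ,
          (1 - Real.cos (⟪(2 * Real.pi) • t, a k⟫ * (p.1 - p.2))) ∂(ν.prod ν)) :=
        Finset.prod_le_prod (fun _ _ => norm_nonneg _) fun k _ => norm_charFun_le_exp ν _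
    _ = _ := by
        rw [← Real.exp_sum, ← Finset.mul_sum, ← integral_finsetSum]
        · congr 3
          ext p
          refine Finset.sum_congr rfl fun k _ => ?_
          rw [real_inner_smul_left, real_inner_smul_left]
          congr 2
          ring
        · intro k _
          refine Integrable.of_bound (C := 2) (Continuous.aestronglyMeasurable (by fun_prop))
            (Filter.Eventually.of_forall fun p => ?_)
          rw [Real.norm_of_nonneg (sub_nonneg.2 (Real.cos_le_one _))]
          linarith [Real.neg_one_le_cos (⟪(2 * Real.pi) • t, a k⟫ * (p.1 - p.2))]

lemma integral_gaussian_mul_norm_charFun_sumLaw_le {d n : ℕ} {ν : Measure ℝ}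
    [IsProbabilityMeasure ν] {a : Fin n → EuclideanSpace ℝ (Fin d)} (hM : 0 < Mfn ν 1) {B : ℝ}
    (hB : ∀ z : ℝ, z ≠ 0 → ∫ t : EuclideanSpace ℝ (Fin d), Real.exp (-Real.pi * ‖t‖ ^ 2) *
      Real.exp (-(1 / 2) * Mfn ν 1 * (cosEnergy a (z • t) / min (z ^ 2) 1)) ≤ B) :
    ∫ t : EuclideanSpace ℝ (Fin d), Real.exp (-Real.pi * ‖t‖ ^ 2) *
      ‖charFun (sumLaw ν a) ((2 * Real.pi) • t)‖ ≤ B := by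
  set P := ν.prod ν with hP
  set w : ℝ × ℝ → ℝ := fun p => min ((p.1 - p.2) ^ 2) 1 with hw
  have hMw : Mfn ν 1 = ∫ p, w p ∂P := by simp [Mfn, hw, hP]
  set M := Mfn ν 1
  have hw0 : ∀ p, 0 ≤ w p := fun p => le_min (sq_nonneg _) zero_le_one
  have hw1 : ∀ p, w p ≤ 1 := fun p => min_le_right _ _
  have hwc : Continuous w := by fun_prop
  have hwi : Integrable w P := Integrable.of_bound (C := 1) hwc.aestronglyMeasurable
    (Filter.Eventually.of_forall fun p => by rw [Real.norm_of_nonneg (hw0 p)]; exact hw1 p)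
  have hEc := continuous_cosEnergy a
  set g : EuclideanSpace ℝ (Fin d) → ℝ := fun t => Real.exp (-Real.pi * ‖t‖ ^ 2) with hg
  have hg0 : ∀ t, 0 ≤ g t := fun t => (Real.exp_pos _).le
  have hgc : Continuous g := by fun_prop
  have hgi : Integrable g := integrable_exp_neg_mul_sq_norm Real.pi_pos
  set e : EuclideanSpace ℝ (Fin d) → ℝ × ℝ → ℝ := fun t p =>
    Real.exp (-(1 / 2) * M * (cosEnergy a ((p.1 - p.2) • t) / w p)) with he
  have he0 : ∀ t p, 0 ≤ e t p := fun t p => (Real.exp_pos _).le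
  have he1 : ∀ t p, e t p ≤ 1 := fun t p => Real.exp_le_one_iff.2 <| by
    have := mul_nonneg (mul_nonneg (by norm_num : (0 : ℝ) ≤ 1 / 2) hM.le)
      (div_nonneg (cosEnergy_nonneg a ((p.1 - p.2) • t)) (hw0 p))
    linarith
  have hFi : Integrable (Function.uncurry fun t p => g t * (w p * e t p)) (volume.prod P) := by
    refine (hgi.comp_fst P).mono' ?_ (Filter.Eventually.of_forall fun x => ?_)
    · refine Measurable.aestronglyMeasurable ?_
      have h1 : Measurable fun x : EuclideanSpace ℝ (Fin d) × ℝ × ℝ =>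
          cosEnergy a ((x.2.1 - x.2.2) • x.1) := Continuous.measurable (by fun_prop)
      have h2 : Measurable fun x : EuclideanSpace ℝ (Fin d) × ℝ × ℝ => w x.2 :=
        hwc.measurable.comp measurable_snd
      have h3 : Measurable fun x : EuclideanSpace ℝ (Fin d) × ℝ × ℝ => g x.1 :=
        hgc.measurable.comp measurable_fst
      exact h3.mul (h2.mul ((h1.div h2).const_mul (-(1 / 2) * M)).exp)
    · simp only [Function.uncurry]
      rw [Real.norm_of_nonneg (mul_nonneg (hg0 _) (mul_nonneg (hw0 _) (he0 _ _)))]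
      exact mul_le_of_le_one_right (hg0 _) (mul_le_one₀ (hw1 _) (he0 _ _) (he1 _ _))
  have hpt : ∀ t, ‖charFun (sumLaw ν a) ((2 * Real.pi) • t)‖ ≤ M⁻¹ * ∫ p, w p * e t p ∂P := by
    intro t
    refine (norm_charFun_sumLaw_le ν a t).trans ?_
    simp only [he, hMw]
    refine exp_neg_integral_le P hwi ?_ hw0 (fun p => cosEnergy_nonneg a _) (fun p hp => ?_)
      (hMw ▸ hM) (by norm_num)
    · refine Integrable.of_bound (C := 2 * n) (Continuous.aestronglyMeasurable (by fun_prop))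
        (Filter.Eventually.of_forall fun p => ?_)
      rw [Real.norm_of_nonneg (cosEnergy_nonneg a _)]
      exact cosEnergy_le a _
    · have h0 : p.1 - p.2 = 0 := by
        rcases min_choice ((p.1 - p.2) ^ 2) 1 with h | h
        · exact pow_eq_zero_iff two_ne_zero |>.1 (h.symm.trans hp)
        · exact absurd (h.symm.trans hp) one_ne_zero
      simp [h0, cosEnergy]
  calc ∫ t, g t * ‖charFun (sumLaw ν a) ((2 * Real.pi) • t)‖
      ≤ ∫ t, M⁻¹ * ∫ p, g t * (w p * e t p) ∂P := by
        refine integral_mono_of_nonneg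
          (Filter.Eventually.of_forall fun t => mul_nonneg (hg0 t) (norm_nonneg _))
          (hFi.integral_prod_left.const_mul _) (Filter.Eventually.of_forall fun t => ?_)
        simp only
        rw [integral_const_mul, mul_left_comm]
        exact mul_le_mul_of_nonneg_left (hpt t) (hg0 t)
    _ = M⁻¹ * ∫ p, (∫ t, g t * (w p * e t p)) ∂P := by
        rw [integral_const_mul, integral_integral_swap hFi]
    _ ≤ M⁻¹ * ∫ p, w p * B ∂P := by
        refine mul_le_mul_of_nonneg_left
          (integral_mono hFi.integral_prod_right (hwi.mul_const B) fun p => ?_) (inv_nonneg.2 hM.le)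
        simp_rw [mul_left_comm (g _)]
        rw [integral_const_mul]
        by_cases hz : p.1 - p.2 = 0
        · simp [hw, hz]
        · exact mul_le_mul_of_nonneg_left (hB _ hz) (hw0 p)
    _ = B := by
        rw [integral_mul_const, ← hMw, inv_mul_cancel_left₀ hM.ne']

theorem stmt_4 :
    ∃ c₁ c₂ : ℝ, 0 < c₁ ∧ 0 < c₂ ∧
      ∀ (d n : ℕ), 0 < d →
      ∀ (ν : Measure ℝ), IsProbabilityMeasure ν →
      ∀ (a : Fin n → EuclideanSpace ℝ (Fin d)),
      (covMat a).PosDef →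
      0 < Mfn ν 1 →
      ∀ α γ : ℝ, 0 < α → 0 < γ → γ < 1 →
      (∀ (m : Fin n → ℤ) (t : EuclideanSpace ℝ (Fin d)),
        ‖t‖ ≤ Real.sqrt d →
        min (γ * Real.sqrt (∑ k, ⟪t, a k⟫ ^ 2)) α ≤
          Real.sqrt (∑ k, (⟪t, a k⟫ - m k) ^ 2)) →
      concFn (sumLaw ν a) (Real.sqrt d) ≤
        c₁ ^ d * ((1 / (γ * Real.sqrt (Mfn ν 1))) ^ d
            * (1 / Real.sqrt (covMat a).det)
          + Real.exp (-c₂ * α ^ 2 * Mfn ν 1)) := by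
  have hpi := Real.pi_pos
  refine ⟨Real.exp Real.pi * (Real.exp (Real.pi / 4) * √2) * √Real.pi, 1, by positivity, one_pos,
    fun d n _ ν hν a hN hM α γ hα hγ _ h => ?_⟩
  have : IsProbabilityMeasure (sumLaw ν a) :=
    Measure.isProbabilityMeasure_map (Continuous.aemeasurable (by fun_prop))
  refine ciSup_le fun x => (measure_closedBall_le_integral_charFun (sumLaw ν a) x √d).trans ?_
  have hB := integral_gaussian_mul_norm_charFun_sumLaw_le hM fun z hz =>
    integral_gaussian_mul_exp_cosEnergy_le hN hα hγ hM hz h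
  have hs : 1 ≤ √Real.pi ^ d :=
    one_le_pow₀ (Real.one_le_sqrt.2 (by linarith [Real.pi_gt_three]))
  set T := (1 / (γ * √(Mfn ν 1))) ^ d * (1 / √(covMat a).det)
  set e := Real.exp (-1 * α ^ 2 * Mfn ν 1)
  have he : e ≤ √Real.pi ^ d * e := le_mul_of_one_le_left (Real.exp_pos _).le hs
  rw [Real.sq_sqrt (by positivity), mul_comm Real.pi, Real.exp_nat_mul, mul_pow, mul_pow, mul_assoc,
    mul_assoc]
  refine mul_le_mul_of_nonneg_left (hB.trans ?_) (by positivity)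
  refine mul_le_mul_of_nonneg_left ?_ (by positivity)
  linarith
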